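/- With the fused crystal model and Gelfand–Tsetlin patterns of the context: fix row types Θ = (Θ₁,…,Θ_r) ∈ {Γ,Δ}^r and let Θ' = (Θ₁,…,Θ_{r−1}). Then the map ι_Θ, which assigns to an admissible state 𝔰 ∈ 𝔖^Θ_{λ+ρ} the triangular array whose row 0 lists in decreasing order the column numbers of the occupied top boundary edges, and whose row i (1 ≤ i ≤ r−1) lists in decreasing order the column numbers of the occupied vertical edges between lattice rows i and i+1, is well defined (in particular, exactly r−i vertical edges below lattice row i are occupied for each 0 ≤ i ≤ r−1) and is a bijection from 𝔖^Θ_{λ+ρ} onto GTP^{Θ'}_{λ+ρ}. -/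

import Mathlib

namespace Crystal

/-- Row types of the fused crystal model: `Γ` (right-moving) and `Δ` (left-moving). -/
inductive GD | G | D
deriving DecidableEq

/-- A state of the fused crystal grid with `r` rows and `N` columns: spins in `{0,1,…,m}`
on all horizontal and vertical edges. -/
structure CState (m r N : ℕ) where
  hor : Fin r → Fin (N + 1) → Fin (m + 1)
  ver : Fin (r + 1) → Fin N → Fin (m + 1)

/-- The Γ-weight of a configuration `(left, top, right, bottom) = (a,b,c,d)` with row
parameter `z`. -/
noncomputable def wtG {K : Type*} [Field K] (z : K) (a b c d : ℕ) : K :=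
  if a = 0 ∧ b = 0 ∧ c = 0 ∧ d = 0 then 1
  else if a ≠ 0 ∧ b ≠ 0 ∧ c = a ∧ d = b then (if a = b then z else if b < a then 1 else 0)
  else if a ≠ 0 ∧ b ≠ 0 ∧ a ≠ b ∧ c = b ∧ d = a then (if a < b then z else 0)
  else if a = 0 ∧ b ≠ 0 ∧ c = 0 ∧ d = b then 0
  else if a ≠ 0 ∧ b = 0 ∧ c = a ∧ d = 0 then z
  else if a ≠ 0 ∧ b = 0 ∧ c = 0 ∧ d = a then z
  else if a = 0 ∧ b ≠ 0 ∧ c = b ∧ d = 0 then 1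
  else 0

/-- The Δ-weight of a configuration `(left, top, right, bottom) = (a,b,c,d)` with row
parameter `z`. -/
noncomputable def wtD {K : Type*} [Field K] (z : K) (a b c d : ℕ) : K :=
  if a = 0 ∧ b = 0 ∧ c = 0 ∧ d = 0 then z
  else if a ≠ 0 ∧ b ≠ 0 ∧ c = a ∧ d = b then (if a ≤ b then 1 else 0)
  else if a ≠ 0 ∧ b = a ∧ c ≠ 0 ∧ d = c ∧ c ≠ a then (if a < c then 1 else 0)
  else if a = 0 ∧ b ≠ 0 ∧ c = 0 ∧ d = b then 0
  else if a ≠ 0 ∧ b = 0 ∧ c = a ∧ d = 0 then 1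
  else if a = 0 ∧ b = 0 ∧ c ≠ 0 ∧ d = c then z
  else if a ≠ 0 ∧ b = a ∧ c = 0 ∧ d = 0 then 1
  else 0

/-- The weight of a vertex of row type `ty`. -/
noncomputable def wtVert {K : Type*} [Field K] (ty : GD) (z : K) (a b c d : ℕ) : K :=
  match ty with
  | .G => wtG z a b c d
  | .D => wtD z a b c d

/-- The column number of the column at position `p` from the left
(columns are numbered `N−1, …, 1, 0` from left to right). -/
def colNum (N : ℕ) (p : Fin N) : ℕ := N - 1 - (p : ℕ)

/-- The weight of the vertex of a state `s` at row `t` and column position `p`, with row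
types `Θ` and row parameters `z`. -/
noncomputable def vertexW {K : Type*} [Field K] (m r N : ℕ) (Θ : Fin r → GD)
    (z : Fin r → K) (s : CState m r N) (t : Fin r) (p : Fin N) : K :=
  wtVert (Θ t) (z t) (s.hor t p.castSucc : ℕ) (s.ver t.castSucc p : ℕ)
    (s.hor t p.succ : ℕ) (s.ver t.succ p : ℕ)

/-- The boundary conditions of the fused crystal system `𝔖^Θ_{λ+ρ}`: the vertical edges
above row `1` are unoccupied except the one in column `λ_t + r − t`, which carries color
`γ_t`; the vertical edges below row `r` are unoccupied; and for each row `t` the left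
(resp. right) boundary edge is unoccupied when `Θ_t = Γ` (resp. `Θ_t = Δ`). -/
def boundary (m r N : ℕ) (γ lam : Fin r → ℕ) (Θ : Fin r → GD) (s : CState m r N) : Prop :=
  (∀ p : Fin N, (∀ t : Fin r, colNum N p ≠ lam t + (r - 1 - (t : ℕ))) → s.ver 0 p = 0) ∧
  (∀ p : Fin N, ∀ t : Fin r, colNum N p = lam t + (r - 1 - (t : ℕ)) →
      (s.ver 0 p : ℕ) = γ t) ∧
  (∀ p : Fin N, s.ver (Fin.last r) p = 0) ∧
  (∀ t : Fin r, (Θ t = GD.G → s.hor t 0 = 0) ∧ (Θ t = GD.D → s.hor t (Fin.last N) = 0))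

/-- A state is admissible if every vertex of the grid has nonzero weight. -/
def admissible {K : Type*} [Field K] (m r N : ℕ) (Θ : Fin r → GD) (z : Fin r → K)
    (s : CState m r N) : Prop :=
  ∀ (t : Fin r) (p : Fin N), vertexW m r N Θ z s t p ≠ 0

/-- Membership in the system `𝔖^Θ_{λ+ρ}`. -/
def Sys {K : Type*} [Field K] (m r N : ℕ) (γ lam : Fin r → ℕ) (Θ : Fin r → GD)
    (z : Fin r → K) (s : CState m r N) : Prop :=
  boundary m r N γ lam Θ s ∧ admissible m r N Θ z s

/-- The Boltzmann weight of a state: the product over all vertices of their weights. -/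
noncomputable def wtState {K : Type*} [Field K] (m r N : ℕ) (Θ : Fin r → GD)
    (z : Fin r → K) (s : CState m r N) : K :=
  ∏ t : Fin r, ∏ p : Fin N, vertexW m r N Θ z s t p

/-- The set of column numbers of the occupied vertical edges at level `i` (level `0` is the
top boundary, level `i ≥ 1` is just below lattice row `i`). -/
def occSet (m r N : ℕ) (s : CState m r N) (i : Fin (r + 1)) : Finset ℕ :=
  (Finset.univ.filter fun p : Fin N => s.ver i p ≠ 0).image (colNum N)

/-- The triangular array `ι_Θ(𝔰)` associated to a state: row `i` lists, in decreasing
order, the column numbers of the occupied vertical edges at level `i`. -/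
noncomputable def iotaArr (m r N : ℕ) (s : CState m r N) : ℕ → ℕ → ℕ :=
  fun i j =>
    if h : i < r ∧ i ≤ j ∧ j < r then
      (((occSet m r N s ⟨i, by omega⟩).sort (· ≤ ·)).reverse.getD (j - i) 0)
    else 0

/-- A triangular array, encoded as a function `ℕ → ℕ → ℕ` vanishing outside the triangle,
is a Gelfand–Tsetlin pattern with `r` rows if the interlacing inequalities hold. -/
def IsGTP (r : ℕ) (a : ℕ → ℕ → ℕ) : Prop :=
  (∀ i j, (j < i ∨ r ≤ j) → a i j = 0) ∧
  (∀ i j, 1 ≤ i → i ≤ j → j < r → a (i - 1) (j - 1) ≥ a i j ∧ a i j ≥ a (i - 1) j)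

/-- The row-pair `(i−1, i)` is left-strict (type `Γ`). -/
def RowPairG (r : ℕ) (a : ℕ → ℕ → ℕ) (i : ℕ) : Prop :=
  ∀ j, i ≤ j → j < r → a (i - 1) (j - 1) > a i j ∧ a i j ≥ a (i - 1) j

/-- The row-pair `(i−1, i)` is right-strict (type `Δ`). -/
def RowPairD (r : ℕ) (a : ℕ → ℕ → ℕ) (i : ℕ) : Prop :=
  ∀ j, i ≤ j → j < r → a (i - 1) (j - 1) ≥ a i j ∧ a i j > a (i - 1) j

/-- Membership in `GTP^{Θ'}_μ`: a Gelfand–Tsetlin pattern with top row `μ` whose row-pair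
`(i−1, i)` has type `Θ'_i` for every `1 ≤ i ≤ r−1`; here `Θ' i = Θ_i` is the truncation
of the row types `Θ` (indexed `0`-based: `Θ'_i = Θ ⟨i−1⟩`). -/
def memGTPTyped (r : ℕ) (Θ : Fin r → GD) (μ : ℕ → ℕ) (a : ℕ → ℕ → ℕ) : Prop :=
  IsGTP r a ∧ (∀ j, j < r → a 0 j = μ j) ∧
  ∀ i, ∀ hi : 1 ≤ i ∧ i < r,
    ((Θ ⟨i - 1, by omega⟩ = GD.G → RowPairG r a i) ∧
     (Θ ⟨i - 1, by omega⟩ = GD.D → RowPairD r a i))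

/-- The top row `λ + ρ` (`0`-based: entry `j` is `λ_{j+1} + (r − 1 − j)`). -/
def topRow (r : ℕ) (lam : Fin r → ℕ) : ℕ → ℕ :=
  fun j => (if h : j < r then lam ⟨j, h⟩ else 0) + (r - 1 - j)

/-- The local rule of a lattice row read along its direction of motion: the carried spin `h`
meets the top spin `v`, leaving the carried spin `h'` and the bottom spin `w`. -/
def Step (ty : GD) (h v h' w : ℕ) : Prop :=
  (v = 0 ∧ w = 0 ∧ h' = h) ∨ (h ≠ 0 ∧ v = 0 ∧ h' = 0 ∧ w = h) ∨
  (h = 0 ∧ v ≠ 0 ∧ h' = v ∧ w = 0) ∨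
  (h ≠ 0 ∧ v ≠ 0 ∧
    ((ty = GD.G ∧ h' = max h v ∧ w = min h v) ∨ (ty = GD.D ∧ h' = min h v ∧ w = max h v)))

lemma wtG_ne_zero_iff {K : Type*} [Field K] {z : K} (hz : z ≠ 0) (a b c d : ℕ) :
    wtG z a b c d ≠ 0 ↔ Step GD.G a b c d := by
  unfold wtG Step
  split_ifs <;> simp [hz] <;> grind

lemma wtD_ne_zero_iff {K : Type*} [Field K] {z : K} (hz : z ≠ 0) (a b c d : ℕ) :
    wtD z a b c d ≠ 0 ↔ Step GD.D c b a d := by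
  unfold wtD Step
  split_ifs <;> simp [hz] <;> grind

lemma Step.unique {ty : GD} {h v h₁ w₁ h₂ w₂ : ℕ} (s₁ : Step ty h v h₁ w₁)
    (s₂ : Step ty h v h₂ w₂) (hw : w₁ = 0 ↔ w₂ = 0) : h₁ = h₂ ∧ w₁ = w₂ := by
  unfold Step at s₁ s₂
  grind

/-- The column number of the `q`-th vertex of a row, read along its direction of motion. -/
def col (ty : GD) (N q : ℕ) : ℕ :=
  match ty with
  | .G => N - 1 - q
  | .D => q

/-- The number of elements of `S` among the first `q` columns along the direction of motion. -/
def before (ty : GD) (N : ℕ) (S : Finset ℕ) (q : ℕ) : ℕ :=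
  match ty with
  | .G => (S.filter fun y => N - q ≤ y).card
  | .D => (S.filter fun y => y < q).card

lemma before_zero (ty : GD) (N : ℕ) {S : Finset ℕ} (hS : S ⊆ Finset.range N) :
    before ty N S 0 = 0 := by
  cases ty
  · simp only [before, Finset.card_eq_zero, Finset.filter_eq_empty_iff]
    intro y hy
    have := Finset.mem_range.1 (hS hy)
    omega
  · simp [before]

lemma before_self (ty : GD) (N : ℕ) {S : Finset ℕ} (hS : S ⊆ Finset.range N) :
    before ty N S N = S.card := by
  cases ty
  · simp [before]
  · simp only [before]
    rw [Finset.filter_true_of_mem]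
    intro y hy
    exact Finset.mem_range.1 (hS hy)

lemma card_filter_eq_add {S : Finset ℕ} {p p' : ℕ → Prop} [DecidablePred p] [DecidablePred p']
    {a : ℕ} (ha : ¬ p a) (h : ∀ y, p' y ↔ y = a ∨ p y) :
    (S.filter p').card = (S.filter p).card + if a ∈ S then 1 else 0 := by
  by_cases hS : a ∈ S
  · rw [if_pos hS, ← Finset.card_insert_of_notMem (a := a) (by simp [ha])]
    congr 1
    ext y
    simp only [Finset.mem_filter, Finset.mem_insert, h]
    constructor
    · tauto
    · rintro (rfl | h1) <;> tauto
  · rw [if_neg hS, add_zero]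
    congr 1
    refine Finset.filter_congr fun y hy => ?_
    have : y ≠ a := fun e => hS (e ▸ hy)
    simp [h, this]

lemma before_succ (ty : GD) {N q : ℕ} (S : Finset ℕ) (hq : q < N) :
    before ty N S (q + 1) = before ty N S q + if col ty N q ∈ S then 1 else 0 := by
  cases ty
  · exact card_filter_eq_add (by simp only [col]; omega) fun y => by simp only [col]; omega
  · exact card_filter_eq_add (by simp only [col]; omega) fun y => by simp only [col]; omega

lemma col_lt (ty : GD) {N q : ℕ} (hq : q < N) : col ty N q < N := by
  cases ty <;> simp only [col] <;> omega

lemma col_col (ty : GD) {N c : ℕ} (hc : c < N) : col ty N (col ty N c) = c := by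
  cases ty <;> simp only [col]; omega

/-- The occupied columns of a row of vertical spins. -/
def occ (N : ℕ) (v : ℕ → ℕ) : Finset ℕ := (Finset.range N).filter fun c => v c ≠ 0

lemma occ_subset (N : ℕ) (v : ℕ → ℕ) : occ N v ⊆ Finset.range N := Finset.filter_subset _ _

lemma mem_occ {N : ℕ} {v : ℕ → ℕ} {c : ℕ} : c ∈ occ N v ↔ c < N ∧ v c ≠ 0 := by
  simp [occ]

/-- A row of horizontal spins `h`, indexed along the direction of motion, is compatible with the
vertical spins `v` above and `w` below, indexed by column number. -/
def RowOK (ty : GD) (N : ℕ) (h v w : ℕ → ℕ) : Prop :=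
  h 0 = 0 ∧ ∀ q < N, Step ty (h q) (v (col ty N q)) (h (q + 1)) (w (col ty N q))

/-- The interlacing condition on the occupied sets above and below a row, through counts. -/
def Interlace (ty : GD) (N : ℕ) (A B : Finset ℕ) : Prop :=
  (∀ q ≤ N, before ty N A q ≤ before ty N B q + 1) ∧
  (∀ q < N, before ty N B (q + 1) ≤ before ty N A q)

lemma RowOK.before_eq {ty : GD} {N : ℕ} {h v w : ℕ → ℕ} (H : RowOK ty N h v w) {q : ℕ}
    (hq : q ≤ N) :
    before ty N (occ N w) q + (if h q ≠ 0 then 1 else 0) = before ty N (occ N v) q := by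
  induction q with
  | zero => simp [before_zero _ _ (occ_subset _ _), H.1]
  | succ q ih =>
    have h1 := ih (by omega)
    have h2 := H.2 q hq
    have h3 := col_lt ty (show q < N from hq)
    rw [before_succ _ _ hq, before_succ _ _ hq]
    simp only [mem_occ, h3, true_and]
    unfold Step at h2
    grind

lemma RowOK.interlace {ty : GD} {N : ℕ} {h v w : ℕ → ℕ} (H : RowOK ty N h v w) :
    Interlace ty N (occ N v) (occ N w) := by
  constructor
  · intro q hq
    have h1 := H.before_eq hq
    split_ifs at h1 <;> omega
  · intro q hq
    have h1 := H.before_eq hq.le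
    have h2 := H.2 q hq
    have h3 := col_lt ty hq
    rw [before_succ _ _ hq]
    simp only [mem_occ, h3, true_and]
    unfold Step at h2
    grind

lemma RowOK.unique {ty : GD} {N : ℕ} {h v w h' v' w' : ℕ → ℕ} (H : RowOK ty N h v w)
    (H' : RowOK ty N h' v' w') (hv : ∀ c < N, v c = v' c) (hw : occ N w = occ N w') :
    (∀ q ≤ N, h q = h' q) ∧ ∀ c < N, w c = w' c := by
  have hw' : ∀ c < N, (w c = 0 ↔ w' c = 0) := fun c hc => by
    have := congrArg (c ∈ ·) hw
    simp only [mem_occ, hc, true_and, eq_iff_iff] at this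
    tauto
  have key : ∀ q ≤ N, h q = h' q := by
    intro q
    induction q with
    | zero => intro _; rw [H.1, H'.1]
    | succ q ih =>
      intro hq
      have h1 := H.2 q hq
      rw [ih (by omega), hv _ (col_lt ty hq)] at h1
      exact (h1.unique (H'.2 q hq) (hw' _ (col_lt ty hq))).1
  refine ⟨key, fun c hc => ?_⟩
  have hq := col_lt ty hc
  have h1 := H.2 _ hq
  have h2 := H'.2 _ hq
  rw [col_col ty hc] at h1 h2
  rw [key _ hq.le, hv _ hc] at h1
  exact (h1.unique h2 (hw' _ hc)).2

/-- The carried spin and the bottom spin after a vertex, given whether the bottom edge is to be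
occupied. -/
def next (ty : GD) (h v : ℕ) (o : Prop) [Decidable o] : ℕ × ℕ :=
  if h = 0 then (v, 0)
  else if v = 0 then (if o then (0, h) else (h, 0))
  else match ty with
    | .G => (max h v, min h v)
    | .D => (min h v, max h v)

lemma next_le {ty : GD} {h v m : ℕ} (o : Prop) [Decidable o] (hh : h ≤ m) (hv : v ≤ m) :
    (next ty h v o).1 ≤ m ∧ (next ty h v o).2 ≤ m := by
  unfold next
  cases ty <;> grind

lemma step_next {ty : GD} {h v : ℕ} (o : Prop) [Decidable o] :
    Step ty h v (next ty h v o).1 (next ty h v o).2 := by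
  unfold next Step
  cases ty <;> split_ifs <;> simp_all [em]

lemma Interlace.exists_row {ty : GD} {N m : ℕ} {v : ℕ → ℕ} {B : Finset ℕ}
    (hB : B ⊆ Finset.range N) (hv : ∀ c, v c ≤ m) (H : Interlace ty N (occ N v) B) :
    ∃ h w : ℕ → ℕ, (∀ q, h q ≤ m) ∧ (∀ c, w c ≤ m) ∧ occ N w = B ∧ RowOK ty N h v w := by
  let h : ℕ → ℕ := fun q => Nat.rec (motive := fun _ => ℕ) 0
    (fun q x => (next ty x (v (col ty N q)) (col ty N q ∈ B)).1) q
  let u : ℕ → ℕ := fun q => (next ty (h q) (v (col ty N q)) (col ty N q ∈ B)).2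
  have hm : ∀ q, h q ≤ m := by
    intro q
    induction q with
    | zero => exact Nat.zero_le _
    | succ q ih => exact (next_le _ ih (hv _)).1
  let w : ℕ → ℕ := fun c => u (col ty N c)
  have hrow : RowOK ty N h v w := by
    refine ⟨rfl, fun q hq => ?_⟩
    simp only [w, col_col ty hq]
    exact step_next _
  have hu : ∀ q : ℕ, q ≤ N → (before ty N B q + (if h q ≠ 0 then 1 else 0) = before ty N (occ N v) q) ∧
      ∀ q' < q, (w (col ty N q') ≠ 0 ↔ col ty N q' ∈ B) := by
    intro q
    induction q with
    | zero =>
      intro _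
      simp [before_zero _ _ (occ_subset _ _), before_zero _ _ hB, h]
    | succ q ih =>
      intro hq
      obtain ⟨h1, h2⟩ := ih (by omega)
      have h3 := hrow.2 q hq
      have h4 := H.1 (q + 1) hq
      have h5 := H.2 q hq
      have h6 := col_lt ty (show q < N from hq)
      have h7 : (w (col ty N q) ≠ 0 ↔ col ty N q ∈ B) := by
        rw [before_succ _ _ hq, before_succ _ _ hq] at h4
        rw [before_succ _ _ hq] at h5
        simp only [mem_occ, h6, true_and] at h4
        have h8 : w (col ty N q) = (next ty (h q) (v (col ty N q)) (col ty N q ∈ B)).2 := by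
          simp only [w, col_col ty hq, u]
        rw [h8]
        unfold next
        cases ty <;> grind
      refine ⟨?_, ?_⟩
      · rw [before_succ _ _ hq, before_succ _ _ hq]
        simp only [mem_occ, h6, true_and]
        unfold Step at h3
        grind
      · intro q' hq'
        rcases Nat.lt_succ_iff_lt_or_eq.1 hq' with h | rfl
        · exact h2 _ h
        · exact h7
  refine ⟨h, w, hm, fun c => (next_le _ (hm _) (hv _)).2, ?_, hrow⟩
  ext c
  rw [mem_occ]
  constructor
  · rintro ⟨hc, hwc⟩
    have := (hu N le_rfl).2 _ (col_lt ty hc)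
    rw [col_col ty hc] at this
    exact this.1 hwc
  · intro hc
    have hcN := Finset.mem_range.1 (hB hc)
    have := (hu N le_rfl).2 _ (col_lt ty hcN)
    rw [col_col ty hcN] at this
    exact ⟨hcN, this.2 hc⟩

/-- The number of elements of `S` that are at least `x`. -/
def cntGe (S : Finset ℕ) (x : ℕ) : ℕ := (S.filter fun y => x ≤ y).card

lemma cntGe_le_card (S : Finset ℕ) (x : ℕ) : cntGe S x ≤ S.card := Finset.card_filter_le _ _

lemma before_D_add_cntGe (N : ℕ) (S : Finset ℕ) (q : ℕ) :
    before GD.D N S q + cntGe S q = S.card := by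
  simp only [before, cntGe]
  rw [← Finset.card_filter_add_card_filter_not (s := S) (fun y => y < q)]
  simp only [not_lt]

lemma cntGe_eq_zero {S : Finset ℕ} {N x : ℕ} (hS : S ⊆ Finset.range N) (hx : N ≤ x) :
    cntGe S x = 0 := by
  simp only [cntGe, Finset.card_eq_zero, Finset.filter_eq_empty_iff]
  intro y hy
  have := Finset.mem_range.1 (hS hy)
  omega

lemma interlace_G_iff {N : ℕ} {A B : Finset ℕ} (hA : A ⊆ Finset.range N)
    (hB : B ⊆ Finset.range N) :
    Interlace GD.G N A B ↔
      ∀ x, cntGe B x ≤ cntGe A (x + 1) ∧ cntGe A x ≤ cntGe B x + 1 := by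
  constructor
  · rintro ⟨h1, h2⟩ x
    rcases lt_or_ge x N with hx | hx
    · have e1 := h1 (N - x) (by omega)
      have e2 := h2 (N - 1 - x) (by omega)
      simp only [before] at e1 e2
      rw [show N - (N - x) = x by omega] at e1
      rw [show N - (N - 1 - x + 1) = x by omega, show N - (N - 1 - x) = x + 1 by omega] at e2
      exact ⟨e2, e1⟩
    · rw [cntGe_eq_zero hB hx, cntGe_eq_zero hA hx]
      omega
  · intro h
    refine ⟨fun q _ => (h (N - q)).2, fun q hq => ?_⟩
    have := (h (N - (q + 1))).1
    rwa [show N - (q + 1) + 1 = N - q by omega] at this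

lemma interlace_D_iff {N : ℕ} {A B : Finset ℕ} (hA : A ⊆ Finset.range N)
    (hB : B ⊆ Finset.range N) (hAB : A.card = B.card + 1) :
    Interlace GD.D N A B ↔
      ∀ x, cntGe B x ≤ cntGe A x ∧ cntGe A x ≤ cntGe B (x + 1) + 1 := by
  constructor
  · rintro ⟨h1, h2⟩ x
    rcases lt_or_ge x N with hx | hx
    · have e1 := h1 x hx.le
      have e2 := h2 x hx
      have a := before_D_add_cntGe N A x
      have b := before_D_add_cntGe N B x
      have c := before_D_add_cntGe N B (x + 1)
      omega
    · rw [cntGe_eq_zero hB hx, cntGe_eq_zero hA hx]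
      omega
  · intro h
    refine ⟨fun q _ => ?_, fun q hq => ?_⟩ <;>
    · have e := h q
      have a := before_D_add_cntGe N A q
      have b := before_D_add_cntGe N B q
      have c := before_D_add_cntGe N B (q + 1)
      omega

/-- The `j`-th element of `S` in decreasing order. -/
noncomputable def dec (S : Finset ℕ) (j : ℕ) : ℕ := (S.sort (· ≤ ·)).reverse.getD j 0

lemma list_le_getD_iff (L : List ℕ) (hL : L.Pairwise (· > ·)) {j : ℕ} (hj : j < L.length)
    (x : ℕ) : x ≤ L.getD j 0 ↔ j < L.countP (fun y => decide (x ≤ y)) := by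
  induction L generalizing j with
  | nil => simp at hj
  | cons y L ih =>
    rw [List.pairwise_cons] at hL
    by_cases hx : x ≤ y
    · rw [List.countP_cons_of_pos (by simpa using hx)]
      cases j with
      | zero => simp [hx]
      | succ j =>
        rw [List.getD_cons_succ, ih hL.2 (by simpa using hj)]
        omega
    · rw [List.countP_cons_of_neg (by simpa using hx)]
      have h0 : L.countP (fun y => decide (x ≤ y)) = 0 := by
        rw [List.countP_eq_zero]
        intro w hw
        have := hL.1 w hw
        simp
        omega
      rw [h0]
      cases j with
      | zero => simpa using hx
      | succ j =>
        rw [List.getD_cons_succ, ih hL.2 (by simpa using hj), h0]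
        simp

lemma le_dec_iff (S : Finset ℕ) {j : ℕ} (hj : j < S.card) (x : ℕ) :
    x ≤ dec S j ↔ j < cntGe S x := by
  unfold dec
  rw [list_le_getD_iff _ _ (by simpa using hj)]
  · rw [List.countP_reverse]
    have : (S.sort (· ≤ ·)).countP (fun y => decide (x ≤ y)) = cntGe S x := by
      unfold cntGe
      rw [← Multiset.coe_countP, Finset.sort_eq, Multiset.countP_eq_card_filter]
      simp [Finset.card]
    rw [this]
  · rw [List.pairwise_reverse]
    exact Finset.sortedLT_sort S |>.pairwise

lemma mem_iff_dec (S : Finset ℕ) (y : ℕ) : y ∈ S ↔ ∃ j < S.card, dec S j = y := by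
  rw [← Finset.mem_sort (· ≤ ·), ← List.mem_reverse, List.mem_iff_getElem]
  constructor
  · rintro ⟨j, hj, rfl⟩
    exact ⟨j, by simpa using hj, by simp only [dec]; rw [List.getD_eq_getElem _ _ hj]⟩
  · rintro ⟨j, hj, rfl⟩
    have hj' : j < (S.sort (· ≤ ·)).reverse.length := by simpa using hj
    exact ⟨j, hj', by simp only [dec]; rw [List.getD_eq_getElem _ _ hj']⟩

lemma eq_of_dec_eq {S S' : Finset ℕ} (hc : S.card = S'.card)
    (h : ∀ j < S.card, dec S j = dec S' j) : S = S' := by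
  ext y
  rw [mem_iff_dec, mem_iff_dec, ← hc]
  exact exists_congr fun j => and_congr_right fun hj => by rw [h j hj]

lemma card_image_of_anti {f : ℕ → ℕ} {k : ℕ} (hf : ∀ i j, i < j → j < k → f j < f i) :
    ((Finset.range k).image f).card = k := by
  rw [Finset.card_image_of_injOn, Finset.card_range]
  intro i hi j hj e
  simp only [Finset.coe_range, Set.mem_Iio] at hi hj
  rcases lt_trichotomy i j with h | h | h
  · have := hf i j h hj; omega
  · exact h
  · have := hf j i h hi; omega

lemma dec_image {f : ℕ → ℕ} {k : ℕ} (hf : ∀ i j, i < j → j < k → f j < f i) {j : ℕ}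
    (hj : j < k) : dec ((Finset.range k).image f) j = f j := by
  have hinj : Set.InjOn f (Finset.range k) :=
    Finset.card_image_iff.1 (by rw [card_image_of_anti hf, Finset.card_range])
  have key : ∀ x, x ≤ dec ((Finset.range k).image f) j ↔ x ≤ f j := by
    intro x
    rw [le_dec_iff _ (by rwa [card_image_of_anti hf]), cntGe, Finset.filter_image,
      Finset.card_image_of_injOn (hinj.mono (Finset.coe_subset.2 (Finset.filter_subset _ _)))]
    constructor
    · intro h
      by_contra hx
      have : (Finset.range k).filter (fun i => x ≤ f i) ⊆ Finset.range j := by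
        intro i hi
        simp only [Finset.mem_filter, Finset.mem_range] at hi ⊢
        by_contra hij
        rcases Nat.lt_or_eq_of_le (not_lt.1 hij) with h' | rfl
        · have := hf j i h' hi.1; omega
        · omega
      have := Finset.card_le_card this
      rw [Finset.card_range] at this
      omega
    · intro h
      have : Finset.range (j + 1) ⊆ (Finset.range k).filter (fun i => x ≤ f i) := by
        intro i hi
        simp only [Finset.mem_filter, Finset.mem_range] at hi ⊢
        rcases Nat.lt_succ_iff_lt_or_eq.1 hi with h' | rfl
        · have := hf i j h' hj; omega
        · omega
      have := Finset.card_le_card this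
      rw [Finset.card_range] at this
      omega
  exact le_antisymm ((key _).1 le_rfl) ((key _).2 le_rfl)

lemma interlace_G_iff_dec {N : ℕ} {A B : Finset ℕ} (hA : A ⊆ Finset.range N)
    (hB : B ⊆ Finset.range N) (hAB : A.card = B.card + 1) :
    Interlace GD.G N A B ↔
      ∀ j < B.card, dec B j < dec A j ∧ dec A (j + 1) ≤ dec B j := by
  rw [interlace_G_iff hA hB]
  constructor
  · intro h j hj
    constructor
    · have h1 := (le_dec_iff B hj _).1 le_rfl
      exact (le_dec_iff A (by omega) _).2 (h1.trans_le (h _).1)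
    · have h1 := (le_dec_iff A (show j + 1 < A.card by omega) _).1 le_rfl
      have h2 := (h (dec A (j + 1))).2
      exact (le_dec_iff B hj _).2 (by omega)
  · intro h x
    have hBc := cntGe_le_card B x
    have hAc := cntGe_le_card A x
    constructor <;> by_contra hx
    · have hj : cntGe A (x + 1) < B.card := by omega
      have h1 := (le_dec_iff B hj x).2 (by omega)
      have h2 := (le_dec_iff A (show cntGe A (x + 1) < A.card by omega) (x + 1)).1
        (h1.trans_lt (h _ hj).1)
      omega
    · have hj : cntGe B x < B.card := by omega
      have h1 := (le_dec_iff A (show cntGe B x + 1 < A.card by omega) x).2 (by omega)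
      have h2 := (le_dec_iff B hj x).1 (h1.trans (h _ hj).2)
      omega

lemma interlace_D_iff_dec {N : ℕ} {A B : Finset ℕ} (hA : A ⊆ Finset.range N)
    (hB : B ⊆ Finset.range N) (hAB : A.card = B.card + 1) :
    Interlace GD.D N A B ↔
      ∀ j < B.card, dec B j ≤ dec A j ∧ dec A (j + 1) < dec B j := by
  rw [interlace_D_iff hA hB hAB]
  constructor
  · intro h j hj
    constructor
    · have h1 := (le_dec_iff B hj _).1 le_rfl
      exact (le_dec_iff A (by omega) _).2 (h1.trans_le (h _).1)
    · have h1 := (le_dec_iff A (show j + 1 < A.card by omega) _).1 le_rfl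
      have h2 := (h (dec A (j + 1))).2
      exact Nat.succ_le_iff.1 ((le_dec_iff B hj (dec A (j + 1) + 1)).2 (by omega))
  · intro h x
    have hBc := cntGe_le_card B x
    have hAc := cntGe_le_card A x
    constructor <;> by_contra hx
    · have hj : cntGe A x < B.card := by omega
      have h1 := (le_dec_iff B hj x).2 (by omega)
      have h2 := (le_dec_iff A (show cntGe A x < A.card by omega) x).1 (h1.trans (h _ hj).1)
      omega
    · have hj : cntGe B (x + 1) < B.card := by omega
      have h1 := (le_dec_iff A (show cntGe B (x + 1) + 1 < A.card by omega) x).2 (by omega)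
      have h2 := (le_dec_iff B hj (x + 1)).1 (h1.trans_lt (h _ hj).2)
      omega

/-- The index, along the direction of motion, of the horizontal edge in position `e` from the
left. -/
def edge (ty : GD) (N e : ℕ) : ℕ :=
  match ty with
  | .G => e
  | .D => N - e

lemma edge_edge (ty : GD) {N e : ℕ} (he : e ≤ N) : edge ty N (edge ty N e) = e := by
  cases ty <;> simp only [edge]; omega

lemma edge_le (ty : GD) {N e : ℕ} (he : e ≤ N) : edge ty N e ≤ N := by
  cases ty <;> simp only [edge] <;> omega

/-- The functions `H` (horizontal spins, indexed along the direction of motion of each row) and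
`V` (vertical spins, indexed by column number) describe the state `s`. -/
def Describes {m r N : ℕ} (Θ : Fin r → GD) (s : CState m r N) (H V : ℕ → ℕ → ℕ) : Prop :=
  (∀ (t : Fin r) (e : Fin (N + 1)), (s.hor t e : ℕ) = H t (edge (Θ t) N e)) ∧
  ∀ (i : Fin (r + 1)) (p : Fin N), (s.ver i p : ℕ) = V i (colNum N p)

lemma exists_describes {m r N : ℕ} (Θ : Fin r → GD) (s : CState m r N) :
    ∃ H V, Describes Θ s H V := by
  refine ⟨fun i q => if h : i < r ∧ q ≤ N then
      s.hor ⟨i, h.1⟩ ⟨edge (Θ ⟨i, h.1⟩) N q, Nat.lt_succ_of_le (edge_le _ h.2)⟩ else 0,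
    fun i c => if h : i ≤ r ∧ c < N then
      s.ver ⟨i, Nat.lt_succ_of_le h.1⟩ ⟨N - 1 - c, by omega⟩ else 0, ?_, ?_⟩
  · intro t e
    have he : (e : ℕ) ≤ N := Nat.le_of_lt_succ e.2
    dsimp only
    rw [dif_pos ⟨t.2, edge_le _ he⟩]
    simp only [edge_edge _ he, Fin.eta]
  · intro i p
    have hp : (p : ℕ) < N := p.2
    dsimp only
    rw [dif_pos ⟨Nat.le_of_lt_succ i.2, by unfold colNum; omega⟩]
    have : N - 1 - colNum N p = p := by unfold colNum; omega
    simp only [this, Fin.eta]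

lemma exists_state {m r N : ℕ} (Θ : Fin r → GD) {H V : ℕ → ℕ → ℕ} (hH : ∀ i q, H i q ≤ m)
    (hV : ∀ i c, V i c ≤ m) : ∃ s : CState m r N, Describes Θ s H V :=
  ⟨⟨fun t e => ⟨H t (edge (Θ t) N e), Nat.lt_succ_of_le (hH _ _)⟩,
    fun i p => ⟨V i (colNum N p), Nat.lt_succ_of_le (hV _ _)⟩⟩, fun _ _ => rfl, fun _ _ => rfl⟩

lemma forall_colNum {N : ℕ} {P : ℕ → Prop} : (∀ p : Fin N, P (colNum N p)) ↔ ∀ c < N, P c := by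
  constructor
  · intro h c hc
    have := h ⟨N - 1 - c, by omega⟩
    have e : colNum N ⟨N - 1 - c, by omega⟩ = c := by simp only [colNum]; omega
    rwa [e] at this
  · intro h p
    have hp : (p : ℕ) < N := p.2
    exact h _ (by unfold colNum; omega)

/-- The boundary condition above the first row, with vertical spins indexed by column number. -/
def TopOK (r N : ℕ) (γ lam : Fin r → ℕ) (v : ℕ → ℕ) : Prop :=
  (∀ c < N, (∀ t : Fin r, c ≠ lam t + (r - 1 - (t : ℕ))) → v c = 0) ∧
  ∀ c < N, ∀ t : Fin r, c = lam t + (r - 1 - (t : ℕ)) → v c = γ t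

lemma Describes.occSet_eq {m r N : ℕ} {Θ : Fin r → GD} {s : CState m r N} {H V : ℕ → ℕ → ℕ}
    (hs : Describes Θ s H V) (i : Fin (r + 1)) : occSet m r N s i = occ N (V i) := by
  ext c
  simp only [occSet, Finset.mem_image, Finset.mem_filter, Finset.mem_univ, true_and, mem_occ]
  constructor
  · rintro ⟨p, hp, rfl⟩
    have h1 : (p : ℕ) < N := p.2
    refine ⟨by unfold colNum; omega, ?_⟩
    rw [← hs.2]
    exact fun h => hp (Fin.ext h)
  · rintro ⟨hc, hv⟩
    have e : colNum N ⟨N - 1 - c, by omega⟩ = c := by simp only [colNum]; omega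
    refine ⟨⟨N - 1 - c, by omega⟩, fun h => hv ?_, e⟩
    rw [← e, ← hs.2, h]
    rfl

lemma Describes.row_iff {K : Type*} [Field K] {m r N : ℕ} {Θ : Fin r → GD} {s : CState m r N}
    {H V : ℕ → ℕ → ℕ} (hs : Describes Θ s H V) {z : Fin r → K} (hz : ∀ t, z t ≠ 0) (t : Fin r) :
    (((Θ t = GD.G → s.hor t 0 = 0) ∧ (Θ t = GD.D → s.hor t (Fin.last N) = 0)) ∧
      ∀ p : Fin N, vertexW m r N Θ z s t p ≠ 0) ↔ RowOK (Θ t) N (H t) (V t) (V (t + 1)) := by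
  have h0 : ∀ e, s.hor t e = 0 ↔ H t (edge (Θ t) N e) = 0 := fun e => by
    rw [← hs.1, Fin.ext_iff]; rfl
  unfold RowOK
  simp only [h0, vertexW, hs.1, hs.2]
  cases Θ t
  · simp only [edge, wtVert, wtG_ne_zero_iff (hz t), col, Fin.forall_iff, colNum]
    simp
  · simp only [edge, wtVert, wtD_ne_zero_iff (hz t), col]
    rw [← forall_colNum]
    have e1 : ∀ p : Fin N, N - (p.succ : ℕ) = colNum N p := fun p => by
      have := p.2
      simp only [colNum, Fin.val_succ]; omega
    have e2 : ∀ p : Fin N, N - (p.castSucc : ℕ) = colNum N p + 1 := fun p => by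
      have := p.2
      simp only [colNum, Fin.val_castSucc]; omega
    simp only [e1, e2]
    simp

lemma Describes.sys_iff {K : Type*} [Field K] {m r N : ℕ} {γ lam : Fin r → ℕ} {Θ : Fin r → GD}
    {s : CState m r N} {H V : ℕ → ℕ → ℕ} (hs : Describes Θ s H V) {z : Fin r → K}
    (hz : ∀ t, z t ≠ 0) :
    Sys m r N γ lam Θ z s ↔ TopOK r N γ lam (V 0) ∧ (∀ c < N, V r c = 0) ∧
      ∀ t : Fin r, RowOK (Θ t) N (H t) (V t) (V (t + 1)) := by
  have h0 : ∀ i p, s.ver i p = 0 ↔ V i (colNum N p) = 0 := fun i p => by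
    rw [← hs.2, Fin.ext_iff]; rfl
  have h1 : TopOK r N γ lam (V 0) ↔
      (∀ p : Fin N, (∀ t : Fin r, colNum N p ≠ lam t + (r - 1 - (t : ℕ))) → s.ver 0 p = 0) ∧
      (∀ p : Fin N, ∀ t : Fin r, colNum N p = lam t + (r - 1 - (t : ℕ)) →
        (s.ver 0 p : ℕ) = γ t) := by
    simp only [h0, hs.2, TopOK, ← forall_colNum (N := N)]
    rfl
  have h2 : (∀ c < N, V r c = 0) ↔ ∀ p : Fin N, s.ver (Fin.last r) p = 0 := by
    simp only [h0, ← forall_colNum (N := N)]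
    rfl
  rw [h1, h2]
  simp only [← hs.row_iff hz]
  unfold Sys boundary admissible
  simp only [forall_and]
  tauto

lemma topRow_anti {r : ℕ} {lam : Fin r → ℕ} (hmono : ∀ s t : Fin r, s ≤ t → lam t ≤ lam s) :
    ∀ i j, i < j → j < r → topRow r lam j < topRow r lam i := by
  intro i j hij hj
  have hi : i < r := hij.trans hj
  have := hmono ⟨i, hi⟩ ⟨j, hj⟩ hij.le
  simp only [topRow, hj, hi, dif_pos]
  omega

lemma TopOK.occ_eq {r N : ℕ} {γ lam : Fin r → ℕ} {v : ℕ → ℕ} (h : TopOK r N γ lam v)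
    (hγ : ∀ t, 1 ≤ γ t) (hlamN : ∀ t : Fin r, lam t + (r - 1 - (t : ℕ)) < N) :
    occ N v = (Finset.range r).image (topRow r lam) := by
  ext c
  simp only [mem_occ, Finset.mem_image, Finset.mem_range]
  constructor
  · rintro ⟨hc, hv⟩
    by_contra hne
    refine hv (h.1 c hc fun t ht => hne ⟨t, t.2, ?_⟩)
    simp [topRow, ht]
  · rintro ⟨j, hj, rfl⟩
    have e : topRow r lam j = lam ⟨j, hj⟩ + (r - 1 - j) := by simp [topRow, hj]
    have hN : topRow r lam j < N := e ▸ hlamN ⟨j, hj⟩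
    refine ⟨hN, ?_⟩
    rw [h.2 _ hN ⟨j, hj⟩ e]
    have := hγ ⟨j, hj⟩
    omega

lemma exists_topOK {r N m : ℕ} {γ lam : Fin r → ℕ} (hγ : ∀ t, γ t ≤ m)
    (hmono : ∀ s t : Fin r, s ≤ t → lam t ≤ lam s) :
    ∃ v, (∀ c, v c ≤ m) ∧ TopOK r N γ lam v := by
  classical
  have hinj : ∀ t t' : Fin r, lam t + (r - 1 - (t : ℕ)) = lam t' + (r - 1 - (t' : ℕ)) → t = t' := by
    intro t t' e
    have ht := t.2
    have ht' := t'.2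
    rcases lt_trichotomy t t' with h | h | h
    · have := hmono _ _ h.le
      have : (t : ℕ) < t' := h
      omega
    · exact h
    · have := hmono _ _ h.le
      have : (t' : ℕ) < t := h
      omega
  refine ⟨fun c => if h : ∃ t : Fin r, c = lam t + (r - 1 - (t : ℕ)) then γ h.choose else 0,
    fun c => ?_, fun c _ hc => ?_, fun c _ t ht => ?_⟩
  · dsimp only
    split_ifs
    · exact hγ _
    · exact Nat.zero_le _
  · exact dif_neg fun ⟨t, ht⟩ => hc t ht
  · have h : ∃ t : Fin r, c = lam t + (r - 1 - (t : ℕ)) := ⟨t, ht⟩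
    dsimp only
    rw [dif_pos h, hinj _ t (h.choose_spec.symm.trans ht)]

lemma card_occ {r N : ℕ} {Θ : Fin r → GD} {H V : ℕ → ℕ → ℕ} (h0 : (occ N (V 0)).card = r)
    (hr : ∀ c < N, V r c = 0) (h : ∀ t : Fin r, RowOK (Θ t) N (H t) (V t) (V (t + 1)))
    {i : ℕ} (hi : i ≤ r) : (occ N (V i)).card = r - i := by
  have step : ∀ i < r, (occ N (V i)).card ≤ (occ N (V (i + 1))).card + 1 := by
    intro i hi
    have := (h ⟨i, hi⟩).interlace.1 N le_rfl
    simpa [before_self _ _ (occ_subset _ _)] using this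
  have lower : ∀ i ≤ r, r ≤ (occ N (V i)).card + i := by
    intro i
    induction i with
    | zero => intro _; omega
    | succ i ih =>
      intro hi
      have := ih (by omega)
      have := step i hi
      omega
  have hlast : (occ N (V r)).card = 0 := by
    rw [Finset.card_eq_zero, Finset.eq_empty_iff_forall_notMem]
    intro c hc
    rw [mem_occ] at hc
    exact hc.2 (hr c hc.1)
  have upper : ∀ k ≤ r, (occ N (V (r - k))).card ≤ k := by
    intro k
    induction k with
    | zero => intro _; rw [Nat.sub_zero, hlast]
    | succ k ih =>
      intro hk
      have h1 := ih (by omega)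
      have h2 := step (r - (k + 1)) (by omega)
      rw [show r - (k + 1) + 1 = r - k by omega] at h2
      omega
  have h1 := lower i hi
  have h2 := upper (r - i) (by omega)
  rw [show r - (r - i) = i by omega] at h2
  omega

lemma iotaArr_eq {m r N : ℕ} (s : CState m r N) {i j : ℕ} (hi : i < r) (hij : i ≤ j)
    (hj : j < r) : iotaArr m r N s i j = dec (occSet m r N s ⟨i, by omega⟩) (j - i) := by
  rw [iotaArr, dif_pos ⟨hi, hij, hj⟩, dec]

/-- The row pair `(i - 1, i)` of a triangular array is of the given type. -/
def RowPair (ty : GD) (r : ℕ) (a : ℕ → ℕ → ℕ) (i : ℕ) : Prop :=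
  match ty with
  | .G => RowPairG r a i
  | .D => RowPairD r a i

lemma interlace_iff_rowPair {ty : GD} {r N i : ℕ} {a : ℕ → ℕ → ℕ} {A B : Finset ℕ}
    (hA : A ⊆ Finset.range N) (hB : B ⊆ Finset.range N) (hAc : A.card = r - i)
    (hBc : B.card = r - (i + 1)) (hi : i < r) (ha : ∀ j, i ≤ j → j < r → a i j = dec A (j - i))
    (hb : ∀ j, i + 1 ≤ j → j < r → a (i + 1) j = dec B (j - (i + 1))) :
    Interlace ty N A B ↔ RowPair ty r a (i + 1) := by
  have key : ∀ P : ℕ → ℕ → ℕ → Prop,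
      (∀ j < B.card, P (dec A j) (dec B j) (dec A (j + 1))) ↔
      ∀ j, i + 1 ≤ j → j < r → P (a i (j - 1)) (a (i + 1) j) (a i j) := by
    intro P
    constructor
    · intro h j h1 h2
      have := h (j - (i + 1)) (by omega)
      rw [ha _ (by omega) (by omega), ha _ (by omega) h2, hb _ h1 h2]
      rwa [show j - 1 - i = j - (i + 1) by omega, show j - i = j - (i + 1) + 1 by omega]
    · intro h j hj
      have := h (j + (i + 1)) (by omega) (by omega)
      rw [ha _ (by omega) (by omega), ha _ (by omega) (by omega), hb _ (by omega) (by omega)] at this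
      rwa [show j + (i + 1) - 1 - i = j by omega, show j + (i + 1) - i = j + 1 by omega,
        Nat.add_sub_cancel] at this
  cases ty
  · rw [interlace_G_iff_dec hA hB (by omega), key fun x y z => y < x ∧ z ≤ y]
    rfl
  · rw [interlace_D_iff_dec hA hB (by omega), key fun x y z => y ≤ x ∧ z < y]
    rfl

lemma memGTPTyped_iff {r : ℕ} {Θ : Fin r → GD} {μ : ℕ → ℕ} {a : ℕ → ℕ → ℕ} :
    memGTPTyped r Θ μ a ↔ (∀ i j, (j < i ∨ r ≤ j) → a i j = 0) ∧ (∀ j < r, a 0 j = μ j) ∧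
      ∀ i, ∀ hi : i + 1 < r, RowPair (Θ ⟨i, by omega⟩) r a (i + 1) := by
  constructor
  · rintro ⟨h1, h2, h3⟩
    refine ⟨h1.1, h2, fun i hi => ?_⟩
    have := h3 (i + 1) ⟨by omega, hi⟩
    simp only [Nat.add_sub_cancel] at this
    cases h : Θ ⟨i, by omega⟩
    · exact this.1 h
    · exact this.2 h
  · rintro ⟨h1, h2, h3⟩
    refine ⟨⟨h1, fun i j hi hij hj => ?_⟩, h2, fun i hi => ?_⟩
    · obtain ⟨i, rfl⟩ := Nat.exists_eq_add_of_le' hi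
      have := h3 i (by omega)
      cases h : Θ ⟨i, by omega⟩ <;> rw [h] at this
      · exact ⟨(this j hij hj).1.le, (this j hij hj).2⟩
      · exact ⟨(this j hij hj).1, (this j hij hj).2.le⟩
    · obtain ⟨i, rfl⟩ := Nat.exists_eq_add_of_le' hi.1
      have := h3 i (by omega)
      simp only [Nat.add_sub_cancel]
      constructor <;> intro h <;> rw [h] at this <;> exact this

lemma RowPair.anti {ty : GD} {r i : ℕ} {a : ℕ → ℕ → ℕ} (h : RowPair ty r a (i + 1)) {j : ℕ}
    (hij : i + 1 ≤ j) (hj : j + 1 < r) : a (i + 1) (j + 1) < a (i + 1) j := by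
  cases ty
  · exact (h (j + 1) (by omega) hj).1.trans_le (h j hij (by omega)).2
  · exact lt_of_le_of_lt (h (j + 1) (by omega) hj).1 (h j hij (by omega)).2

lemma RowPair.le {ty : GD} {r i : ℕ} {a : ℕ → ℕ → ℕ} (h : RowPair ty r a (i + 1)) {j : ℕ}
    (hij : i + 1 ≤ j) (hj : j < r) : a (i + 1) j ≤ a i (j - 1) := by
  cases ty
  · exact (h j hij hj).1.le
  · exact (h j hij hj).1

lemma lt_of_step {f : ℕ → ℕ} {k : ℕ} (h : ∀ j, j + 1 < k → f (j + 1) < f j) :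
    ∀ i j, i < j → j < k → f j < f i := by
  intro i j hij
  induction j, hij using Nat.le_induction with
  | base => exact h i
  | succ j hj ih => exact fun hk => (h j hk).trans (ih (by omega))

lemma exists_rows {N m : ℕ} {Θ : ℕ → GD} {S : ℕ → Finset ℕ} {top : ℕ → ℕ}
    (htop : ∀ c, top c ≤ m) (hocc : occ N top = S 0) (hS : ∀ i, S i ⊆ Finset.range N)
    (hint : ∀ i, Interlace (Θ i) N (S i) (S (i + 1))) :
    ∃ H V : ℕ → ℕ → ℕ, V 0 = top ∧ (∀ i q, H i q ≤ m) ∧ (∀ i c, V i c ≤ m) ∧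
      (∀ i, occ N (V i) = S i) ∧ ∀ i, RowOK (Θ i) N (H i) (V i) (V (i + 1)) := by
  have ex : ∀ i (v : {v : ℕ → ℕ // (∀ c, v c ≤ m) ∧ occ N v = S i}),
      ∃ (h : ℕ → ℕ) (w : {v : ℕ → ℕ // (∀ c, v c ≤ m) ∧ occ N v = S (i + 1)}),
        (∀ q, h q ≤ m) ∧ RowOK (Θ i) N h v.1 w.1 := by
    rintro i ⟨v, hv, hvS⟩
    obtain ⟨h, w, h1, h2, h3, h4⟩ :=
      Interlace.exists_row (hS (i + 1)) hv (by rw [hvS]; exact hint i)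
    exact ⟨h, ⟨w, h2, h3⟩, h1, h4⟩
  choose h w hm hrow using ex
  let V : (i : ℕ) → {v : ℕ → ℕ // (∀ c, v c ≤ m) ∧ occ N v = S i} :=
    fun i => Nat.rec ⟨top, htop, hocc⟩ (fun i v => w i v) i
  exact ⟨fun i => h i (V i), fun i => (V i).1, rfl, fun i => hm i _, fun i => (V i).2.1,
    fun i => (V i).2.2, fun i => hrow i (V i)⟩

lemma state_ext_of_occSet {K : Type*} [Field K] {m r N : ℕ} {γ lam : Fin r → ℕ}
    {Θ : Fin r → GD} {z : Fin r → K} (hz : ∀ t, z t ≠ 0) {s s' : CState m r N}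
    (hs : Sys m r N γ lam Θ z s) (hs' : Sys m r N γ lam Θ z s')
    (h : ∀ i, occSet m r N s i = occSet m r N s' i) : s = s' := by
  obtain ⟨H, V, hd⟩ := exists_describes Θ s
  obtain ⟨H', V', hd'⟩ := exists_describes Θ s'
  obtain ⟨ht, -, hrow⟩ := (hd.sys_iff hz).1 hs
  obtain ⟨ht', -, hrow'⟩ := (hd'.sys_iff hz).1 hs'
  have hocc : ∀ i ≤ r, occ N (V i) = occ N (V' i) := by
    intro i hi
    have := h ⟨i, Nat.lt_succ_of_le hi⟩
    rwa [hd.occSet_eq, hd'.occSet_eq] at this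
  have hV : ∀ i ≤ r, ∀ c < N, V i c = V' i c := by
    intro i
    induction i with
    | zero =>
      intro _ c hc
      by_cases hex : ∃ t : Fin r, c = lam t + (r - 1 - (t : ℕ))
      · obtain ⟨t, e⟩ := hex
        rw [ht.2 c hc t e, ht'.2 c hc t e]
      · push Not at hex
        rw [ht.1 c hc hex, ht'.1 c hc hex]
    | succ i ih =>
      intro hi
      exact ((hrow ⟨i, hi⟩).unique (hrow' ⟨i, hi⟩) (ih (by omega)) (hocc _ hi)).2
  have hH : ∀ t : Fin r, ∀ q ≤ N, H t q = H' t q := fun t =>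
    ((hrow t).unique (hrow' t) (hV _ t.2.le) (hocc _ t.2)).1
  obtain ⟨hor, ver⟩ := s
  obtain ⟨hor', ver'⟩ := s'
  rw [CState.mk.injEq]
  constructor
  · ext t e
    exact (hd.1 t e).trans ((hH t _ (edge_le _ (Nat.le_of_lt_succ e.2))).trans (hd'.1 t e).symm)
  · ext i p
    have hp := p.2
    exact (hd.2 i p).trans ((hV i (Nat.le_of_lt_succ i.2) _ (by unfold colNum; omega)).trans
      (hd'.2 i p).symm)

/-- The map `ι_Θ` is well defined (in particular, exactly `r−i` vertical
edges at level `i` are occupied) and is a bijection from `𝔖^Θ_{λ+ρ}` onto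
`GTP^{Θ'}_{λ+ρ}`. -/
theorem iota_bijection (m r N : ℕ) (hm : 1 ≤ m) (hr : 1 ≤ r) (hN : 1 ≤ N)
    (K : Type*) [Field K] (z : Fin r → K) (hz : ∀ t, z t ≠ 0)
    (γ : Fin r → ℕ) (hγ : ∀ t, 1 ≤ γ t ∧ γ t ≤ m)
    (lam : Fin r → ℕ) (hmono : ∀ s t : Fin r, s ≤ t → lam t ≤ lam s)
    (hlamN : ∀ t : Fin r, lam t + (r - 1 - (t : ℕ)) < N)
    (Θ : Fin r → GD) :
    (∀ s : CState m r N, Sys (K := K) m r N γ lam Θ z s →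
      ∀ i : Fin (r + 1), (i : ℕ) < r → (occSet m r N s i).card = r - (i : ℕ)) ∧
    (∀ s : CState m r N, Sys (K := K) m r N γ lam Θ z s →
      memGTPTyped r Θ (topRow r lam) (iotaArr m r N s)) ∧
    (∀ s₁ s₂ : CState m r N, Sys (K := K) m r N γ lam Θ z s₁ →
      Sys (K := K) m r N γ lam Θ z s₂ → iotaArr m r N s₁ = iotaArr m r N s₂ → s₁ = s₂) ∧
    (∀ a : ℕ → ℕ → ℕ, memGTPTyped r Θ (topRow r lam) a →
      ∃ s : CState m r N, Sys (K := K) m r N γ lam Θ z s ∧ iotaArr m r N s = a) := by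
  have hanti := topRow_anti hmono
  have hcard : ∀ s : CState m r N, Sys (K := K) m r N γ lam Θ z s →
      ∀ i : Fin (r + 1), (occSet m r N s i).card = r - (i : ℕ) := by
    intro s hs i
    obtain ⟨H, V, hd⟩ := exists_describes Θ s
    obtain ⟨ht, hl, hrow⟩ := (hd.sys_iff hz).1 hs
    rw [hd.occSet_eq]
    refine card_occ ?_ hl hrow (Nat.le_of_lt_succ i.2)
    rw [ht.occ_eq (fun t => (hγ t).1) hlamN, card_image_of_anti hanti]
  refine ⟨fun s hs i _ => hcard s hs i, fun s hs => ?_, fun s s' hs hs' h => ?_, fun a ha => ?_⟩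
  · obtain ⟨H, V, hd⟩ := exists_describes Θ s
    obtain ⟨ht, hl, hrow⟩ := (hd.sys_iff hz).1 hs
    have hiota : ∀ i j, i ≤ j → j < r → iotaArr m r N s i j = dec (occ N (V i)) (j - i) := by
      intro i j hij hj
      rw [iotaArr_eq s (by omega) hij hj, hd.occSet_eq]
    have hc : ∀ i ≤ r, (occ N (V i)).card = r - i := by
      intro i hi
      have := hcard s hs ⟨i, Nat.lt_succ_of_le hi⟩
      rwa [hd.occSet_eq] at this
    refine memGTPTyped_iff.2 ⟨fun i j hij => dif_neg (by omega), fun j hj => ?_, fun i hi => ?_⟩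
    · rw [hiota 0 j (Nat.zero_le _) hj, ht.occ_eq (fun t => (hγ t).1) hlamN, Nat.sub_zero,
        dec_image hanti hj]
    · exact (interlace_iff_rowPair (occ_subset _ _) (occ_subset _ _) (hc i (by omega))
        (hc (i + 1) (by omega)) (by omega) (hiota i) (hiota (i + 1))).1
        (hrow ⟨i, by omega⟩).interlace
  · refine state_ext_of_occSet hz hs hs' fun i => ?_
    refine eq_of_dec_eq (by rw [hcard s hs, hcard s' hs']) fun j hj => ?_
    rw [hcard s hs] at hj
    have := congrFun (congrFun h i) (j + i)
    rw [iotaArr_eq s (by omega) (by omega) (by omega),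
      iotaArr_eq s' (by omega) (by omega) (by omega), Nat.add_sub_cancel] at this
    exact this
  · obtain ⟨h0, h1, h2⟩ := memGTPTyped_iff.1 ha
    let S : ℕ → Finset ℕ := fun i => (Finset.range (r - i)).image fun j => a i (j + i)
    have hlt : ∀ i, ∀ j k, j < k → k < r - i → a i (k + i) < a i (j + i) := by
      intro i
      cases i with
      | zero =>
        intro j k hjk hk
        rw [h1 _ (by omega), h1 _ (by omega)]
        exact hanti _ _ hjk hk
      | succ i =>
        refine lt_of_step fun j hj => ?_
        rw [show j + 1 + (i + 1) = j + (i + 1) + 1 by omega]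
        exact (h2 i (by omega)).anti (by omega) (by omega)
    have hSN : ∀ i, S i ⊆ Finset.range N := by
      have hb : ∀ i j, i ≤ j → j < r → a i j < N := by
        intro i
        induction i with
        | zero =>
          intro j _ hj
          rw [h1 j hj, topRow, dif_pos hj]
          exact hlamN ⟨j, hj⟩
        | succ i ih =>
          intro j hij hj
          exact ((h2 i (by omega)).le hij hj).trans_lt (ih _ (by omega) (by omega))
      intro i c hc
      simp only [S, Finset.mem_image, Finset.mem_range] at hc ⊢
      obtain ⟨j, hj, rfl⟩ := hc
      exact hb _ _ (by omega) (by omega)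
    have hSc : ∀ i, (S i).card = r - i := fun i => card_image_of_anti (hlt i)
    have hSd : ∀ i j, i ≤ j → j < r → a i j = dec (S i) (j - i) := by
      intro i j hij hj
      rw [dec_image (hlt i) (by omega), Nat.sub_add_cancel hij]
    let ty : ℕ → GD := fun i => if h : i < r then Θ ⟨i, h⟩ else GD.G
    have hint : ∀ i, Interlace (ty i) N (S i) (S (i + 1)) := by
      intro i
      rcases lt_or_ge i r with hi | hi
      · refine (interlace_iff_rowPair (hSN i) (hSN (i + 1)) (hSc i) (hSc (i + 1)) hi (hSd i)
          (hSd (i + 1))).2 ?_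
        simp only [ty, dif_pos hi]
        rcases Nat.lt_or_eq_of_le (Nat.succ_le_iff.2 hi) with h | h
        · exact h2 i h
        · unfold RowPair
          split <;> intro j h3 h4 <;> omega
      · have e1 : S i = ∅ := Finset.card_eq_zero.1 (by rw [hSc]; omega)
        have e2 : S (i + 1) = ∅ := Finset.card_eq_zero.1 (by rw [hSc]; omega)
        rw [e1, e2]
        refine ⟨fun q _ => Nat.le_succ _, fun q _ => ?_⟩
        unfold before
        split <;> simp
    obtain ⟨top, htop, hok⟩ := exists_topOK (N := N) (fun t => (hγ t).2) hmono
    have hS0 : occ N top = S 0 := by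
      rw [hok.occ_eq (fun t => (hγ t).1) hlamN]
      exact Finset.image_congr fun j hj => (h1 j (by simpa using hj)).symm
    obtain ⟨H, V, hV0, hH, hV, hocc, hrow⟩ := exists_rows htop hS0 hSN hint
    obtain ⟨s, hd⟩ := exists_state (r := r) (N := N) Θ hH hV
    refine ⟨s, (hd.sys_iff hz).2 ⟨hV0 ▸ hok, fun c hc => ?_, fun t => ?_⟩, ?_⟩
    · by_contra hne
      have : c ∈ S r := hocc r ▸ mem_occ.2 ⟨hc, hne⟩
      simp [S] at this
    · have := hrow t
      simpa only [ty, dif_pos t.2] using this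
    · funext i j
      by_cases hij : i ≤ j ∧ j < r
      · rw [iotaArr_eq s (by omega) hij.1 hij.2, hd.occSet_eq, hocc, hSd i j hij.1 hij.2]
      · rw [h0 i j (by omega)]
        exact dif_neg (by omega)

end Crystal
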